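/- arXiv:0809.2627 — 2 statements merged into one kernel-verified Lean document; each statement's English description precedes it below -/
import Mathlib

section
/- Let B be a pair algebra with Σ-structure over a commutative ring k, and let M• = (M_n, d_n, H_n) be a secondary chain complex over B all of whose terms M_n carry Σ-structures and all of whose morphisms d_n are Σ-maps. If the chain complex π₀M• of π₀B-modules (with differentials π₀d_n) is exact, then the secondary chain complex M• is exact, i.e., its total complex is an exact complex. -/
open MulOpposite

universe u

variable (k : Type u) [CommRing k]

/-- A pair algebra over the commutative ring `k` (the degreewise data of the graded notion):
`B₀` is a `k`-algebra, `B₁` a `B₀`-`B₀`-bimodule, `∂ : B₁ → B₀` a bimodule map with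
`∂(x)·y = x·∂(y)`. -/
structure PairAlgebra : Type (u + 1) where
  B0 : Type u
  B1 : Type u
  [ring0 : Ring B0]
  [alg0 : Algebra k B0]
  [ab1 : AddCommGroup B1]
  [left1 : Module B0 B1]
  [right1 : Module B0ᵐᵒᵖ B1]
  [bimod1 : SMulCommClass B0 B0ᵐᵒᵖ B1]
  d : B1 →ₗ[B0] B0
  d_right : ∀ (f : B0) (x : B1), d (op f • x) = d x * f
  pair_eq : ∀ x y : B1, d x • y = op (d y) • x

attribute [instance] PairAlgebra.ring0 PairAlgebra.alg0 PairAlgebra.ab1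
  PairAlgebra.left1 PairAlgebra.right1 PairAlgebra.bimod1

variable {k}

/-- A (left) module over a pair algebra `B`:  a map `∂ : M₁ → M₀` of `B₀`-modules together
with a `B₀`-balanced, `B₀`-equivariant pairing `μ̄ : B₁ ⊗_{B₀} M₀ → M₁` satisfying
`∂(μ̄(b⊗m)) = ∂(b)·m` and `μ̄(b⊗∂m) = ∂(b)·m`. -/
structure PairModule (B : PairAlgebra k) : Type (u + 1) where
  M1 : Type u
  M0 : Type u
  [ab1 : AddCommGroup M1]
  [ab0 : AddCommGroup M0]
  [mod1 : Module B.B0 M1]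
  [mod0 : Module B.B0 M0]
  d : M1 →ₗ[B.B0] M0
  mu : B.B1 → M0 → M1
  mu_add_left : ∀ b b' m, mu (b + b') m = mu b m + mu b' m
  mu_add_right : ∀ b m m', mu b (m + m') = mu b m + mu b m'
  mu_smul : ∀ (f : B.B0) b m, mu (f • b) m = f • mu b m
  mu_balanced : ∀ b (f : B.B0) m, mu (op f • b) m = mu b (f • m)
  d_mu : ∀ b m, d (mu b m) = B.d b • m
  mu_d : ∀ b m, mu b (d m) = B.d b • m

attribute [instance] PairModule.ab1 PairModule.ab0 PairModule.mod1 PairModule.mod0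

variable {B : PairAlgebra k}

/-- `π₀` of a pair module: the cokernel of `∂`. -/
abbrev PairModule.pi0 (M : PairModule B) : Type u := M.M0 ⧸ LinearMap.range M.d

/-- `π₁` of a pair module: the kernel of `∂`. -/
abbrev PairModule.pi1 (M : PairModule B) : Submodule B.B0 M.M1 := LinearMap.ker M.d

/-- Morphisms of modules over a pair algebra. -/
structure PairHom (M N : PairModule B) where
  f1 : M.M1 →ₗ[B.B0] N.M1
  f0 : M.M0 →ₗ[B.B0] N.M0
  comm : N.d.comp f1 = f0.comp M.d
  mu_comm : ∀ b m, f1 (M.mu b m) = N.mu b (f0 m)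

namespace PairHom

variable {M N : PairModule B}

theorem comm_apply (f : PairHom M N) (x : M.M1) : N.d (f.f1 x) = f.f0 (M.d x) :=
  congrArg (fun g => g x) f.comm

/-- The induced map on `π₀`. -/
noncomputable def pi0Map (f : PairHom M N) : M.pi0 →ₗ[B.B0] N.pi0 :=
  Submodule.mapQ _ _ f.f0 (by
    rintro x ⟨y, rfl⟩
    exact ⟨f.f1 y, (f.comm_apply y).symm ▸ rfl⟩)

theorem pi0Map_mk (f : PairHom M N) (x : M.M0) :
    f.pi0Map (Submodule.Quotient.mk x) = Submodule.Quotient.mk (f.f0 x) := rfl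

/-- The induced map on `π₁`. -/
def pi1Map (f : PairHom M N) : M.pi1 →ₗ[B.B0] N.pi1 :=
  f.f1.restrict (fun x hx => by
    simp only [PairModule.pi1, LinearMap.mem_ker] at *
    rw [f.comm_apply, hx, map_zero])

end PairHom

/-- Homotopy of morphisms of modules over a pair algebra. -/
def PairHomotopic {M N : PairModule B} (f g : PairHom M N) : Prop :=
  ∃ H : M.M0 →ₗ[B.B0] N.M1, N.d.comp H = f.f0 - g.f0 ∧ H.comp M.d = f.f1 - g.f1


/-- A secondary chain complex over a pair algebra `B`: `B`-modules `Mₙ`, morphisms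
`dₙ : M_{n+1} → Mₙ` and `B₀`-linear maps `Hₙ : M_{n+2,0} → M_{n,1}` with
`d_{n,0}d_{n+1,0} = ∂ₙHₙ`, `d_{n,1}d_{n+1,1} = Hₙ∂_{n+2}` and `Hₙd_{n+2,0} = d_{n,1}H_{n+1}`. -/
structure SecondaryComplex (B : PairAlgebra k) : Type (u + 1) where
  M : ℤ → PairModule B
  d : ∀ n : ℤ, PairHom (M (n + 1)) (M n)
  H : ∀ n : ℤ, (M (n + 1 + 1)).M0 →ₗ[B.B0] (M n).M1
  eq0 : ∀ n, (d n).f0.comp (d (n + 1)).f0 = (M n).d.comp (H n)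
  eq1 : ∀ n, (d n).f1.comp (d (n + 1)).f1 = (H n).comp (M (n + 1 + 1)).d
  eq2 : ∀ n, (H n).comp (d (n + 1 + 1)).f0 = (d n).f1.comp (H (n + 1))

/-- Exactness of a secondary chain complex: every secondary cycle of its total complex is a
secondary boundary. -/
def SecondaryComplex.IsExact (C : SecondaryComplex B) : Prop :=
  ∀ (n : ℤ) (c : (C.M (n + 1 + 1)).M0) (γ : (C.M (n + 1)).M1),
    (C.d (n + 1)).f0 c = (C.M (n + 1)).d γ →
    C.H n c = (C.d n).f1 γ →
    ∃ (b : (C.M (n + 1 + 1 + 1)).M0) (β : (C.M (n + 1 + 1)).M1),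
      c = (C.d (n + 1 + 1)).f0 b + (C.M (n + 1 + 1)).d β ∧
      γ = C.H (n + 1) b + (C.d (n + 1)).f1 β

/-- A `Σ`-structure on the pair algebra `B`:  an isomorphism `π₁B ≅ Σπ₀B` of
`π₀B`-`π₀B`-bimodules (the right compatibility is stated via representatives). -/
structure PairAlgebra.SigmaStructure (B : PairAlgebra k) where
  e : (LinearMap.ker B.d : Submodule B.B0 B.B1) ≃ₗ[B.B0]
      (B.B0 ⧸ (LinearMap.range B.d : Submodule B.B0 B.B0))
  right_compat : ∀ (x : LinearMap.ker B.d) (f : B.B0) (y : B.B0),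
    e x = Submodule.Quotient.mk y →
    e ⟨op f • (x : B.B1), by
        have hx : B.d (x : B.B1) = 0 := x.2
        simp only [LinearMap.mem_ker, B.d_right, hx, zero_mul]⟩ =
      Submodule.Quotient.mk (y * f)

/-- A `Σ`-structure compatible with the differentials transports exactness of `π₀M•` to
`π₁M•`. -/
theorem SecondaryComplex.exists_pi1Map_eq (C : SecondaryComplex B)
    (σ : ∀ n : ℤ, ((C.M n).pi1 : Type u) ≃ₗ[B.B0] (C.M n).pi0)
    (hσ : ∀ (n : ℤ) (x : (C.M (n + 1)).pi1),
      σ n ((C.d n).pi1Map x) = (C.d n).pi0Map (σ (n + 1) x))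
    (n : ℤ)
    (hexact : LinearMap.ker ((C.d n).pi0Map) = LinearMap.range ((C.d (n + 1)).pi0Map))
    (x : (C.M (n + 1)).pi1) (hx : (C.d n).pi1Map x = 0) :
    ∃ y, (C.d (n + 1)).pi1Map y = x := by
  have hmem : σ (n + 1) x ∈ LinearMap.ker ((C.d n).pi0Map) := by
    rw [LinearMap.mem_ker, ← hσ, hx, map_zero]
  rw [hexact] at hmem
  obtain ⟨z, hz⟩ := hmem
  refine ⟨(σ (n + 1 + 1)).symm z, (σ (n + 1)).injective ?_⟩
  rw [hσ, LinearEquiv.apply_symm_apply, hz]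

/-- **Statement 2.**  Let `B` be a pair algebra with `Σ`-structure and `M•` a secondary
chain complex of `B`-modules with `Σ`-structures whose differentials are `Σ`-maps.  If the
chain complex `π₀M•` of `π₀B`-modules is exact, then the secondary chain complex `M•` is
exact (its total complex is exact). -/
theorem secondaryComplex_isExact_of_pi0_exact
    (σB : B.SigmaStructure) (C : SecondaryComplex B)
    (σ : ∀ n : ℤ, ((C.M n).pi1 : Type u) ≃ₗ[B.B0] (C.M n).pi0)
    (hσ : ∀ (n : ℤ) (x : (C.M (n + 1)).pi1),
      σ n ((C.d n).pi1Map x) = (C.d n).pi0Map (σ (n + 1) x))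
    (hexact : ∀ n : ℤ,
      LinearMap.ker ((C.d n).pi0Map) = LinearMap.range ((C.d (n + 1)).pi0Map)) :
    C.IsExact := by
  intro n c γ hc hγ
  have hmem : (Submodule.Quotient.mk c : (C.M (n + 1 + 1)).pi0) ∈
      LinearMap.ker ((C.d (n + 1)).pi0Map) := by
    rw [LinearMap.mem_ker, PairHom.pi0Map_mk, Submodule.Quotient.mk_eq_zero]
    exact ⟨γ, hc.symm⟩
  rw [hexact] at hmem
  obtain ⟨z, hz⟩ := hmem
  obtain ⟨b, rfl⟩ := Submodule.Quotient.mk_surjective _ z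
  rw [PairHom.pi0Map_mk, eq_comm, Submodule.Quotient.eq] at hz
  obtain ⟨β, hβ⟩ := hz
  obtain rfl : c = (C.d (n + 1 + 1)).f0 b + (C.M (n + 1 + 1)).d β := by
    rw [hβ, add_sub_cancel]
  have h0 : (C.d (n + 1)).f0 ((C.d (n + 1 + 1)).f0 b) = (C.M (n + 1)).d (C.H (n + 1) b) :=
    LinearMap.congr_fun (C.eq0 (n + 1)) b
  have h1 : (C.d n).f1 ((C.d (n + 1)).f1 β) = C.H n ((C.M (n + 1 + 1)).d β) :=
    LinearMap.congr_fun (C.eq1 n) β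
  have h2 : C.H n ((C.d (n + 1 + 1)).f0 b) = (C.d n).f1 (C.H (n + 1) b) :=
    LinearMap.congr_fun (C.eq2 n) b
  have hker : γ - (C.H (n + 1) b + (C.d (n + 1)).f1 β) ∈ (C.M (n + 1)).pi1 := by
    rw [LinearMap.mem_ker, map_sub, map_add, ← hc, map_add, h0, PairHom.comm_apply, sub_self]
  have hcycle : (C.d n).pi1Map ⟨_, hker⟩ = 0 := Subtype.ext <| by
    change (C.d n).f1 (γ - (C.H (n + 1) b + (C.d (n + 1)).f1 β)) = 0
    rw [map_sub, map_add, ← hγ, map_add, h1, h2, sub_self]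
  obtain ⟨y, hy⟩ := C.exists_pi1Map_eq σ hσ n (hexact n) _ hcycle
  have hy' : (C.d (n + 1)).f1 (y : (C.M (n + 1 + 1)).M1) =
      γ - (C.H (n + 1) b + (C.d (n + 1)).f1 β) := congrArg Subtype.val hy
  refine ⟨b, β + y, ?_, ?_⟩
  · rw [map_add, LinearMap.mem_ker.mp y.2, add_zero]
  · rw [map_add, hy', ← add_assoc, add_sub_cancel]
end

section
/- Let B be a pair algebra with Σ-structure over a commutative ring k, and let M• = (M_n, d_n, H_n) be a secondary chain complex over B all of whose terms M_n carry Σ-structures and all of whose morphisms d_n are Σ-maps. If M• is exact (its total complex is exact) and π₀M• is bounded below (there is n₀ with π₀M_n = 0 for all n < n₀), then the chain complex π₀M• of π₀B-modules is exact. -/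
open MulOpposite

universe u

variable (k : Type u) [CommRing k]

variable {k}

variable {B : PairAlgebra k}

namespace SecondaryComplex

/-- Consecutive differentials of `π₀` compose to zero. -/
theorem range_pi0Map_le_ker (C : SecondaryComplex B) (n : ℤ) :
    LinearMap.range ((C.d (n + 1)).pi0Map) ≤ LinearMap.ker ((C.d n).pi0Map) := by
  rintro _ ⟨x, rfl⟩
  obtain ⟨x, rfl⟩ := Submodule.Quotient.mk_surjective _ x
  rw [LinearMap.mem_ker, PairHom.pi0Map_mk, PairHom.pi0Map_mk, Submodule.Quotient.mk_eq_zero]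
  exact ⟨C.H n x, (LinearMap.congr_fun (C.eq0 n) x).symm⟩

/-- If the complex is exact, then exactness of `π₁` at `M (n + 1)` implies exactness of `π₀` at
`M (n + 3)`. -/
theorem IsExact.ker_pi0Map_le_range {C : SecondaryComplex B} (hC : C.IsExact) (n : ℤ)
    (h : LinearMap.ker ((C.d n).pi1Map) ≤ LinearMap.range ((C.d (n + 1)).pi1Map)) :
    LinearMap.ker ((C.d (n + 1 + 1)).pi0Map) ≤
      LinearMap.range ((C.d (n + 1 + 1 + 1)).pi0Map) := by
  intro c hc
  obtain ⟨c, rfl⟩ := Submodule.Quotient.mk_surjective _ c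
  rw [LinearMap.mem_ker, PairHom.pi0Map_mk, Submodule.Quotient.mk_eq_zero] at hc
  obtain ⟨γ, hγ⟩ := hc
  have hx : C.H (n + 1) c - (C.d (n + 1)).f1 γ ∈ (C.M (n + 1)).pi1 := by
    have h0 := LinearMap.congr_fun (C.eq0 (n + 1)) c
    simp only [LinearMap.comp_apply] at h0
    rw [LinearMap.mem_ker, map_sub, PairHom.comm_apply, hγ, h0, sub_self]
  obtain ⟨y, hy⟩ := h (x := ⟨_, hx⟩) (by
    have h1 := LinearMap.congr_fun (C.eq1 n) γ
    have h2 := LinearMap.congr_fun (C.eq2 n) c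
    simp only [LinearMap.comp_apply] at h1 h2
    rw [LinearMap.mem_ker]
    apply Subtype.ext
    change (C.d n).f1 (C.H (n + 1) c - (C.d (n + 1)).f1 γ) = 0
    rw [map_sub, h1, hγ, h2, sub_self])
  have hy' : (C.d (n + 1)).f1 y = C.H (n + 1) c - (C.d (n + 1)).f1 γ :=
    congrArg Subtype.val hy
  have hy0 : (C.M (n + 1 + 1)).d y = 0 := y.2
  obtain ⟨b, β, hb, -⟩ := hC (n + 1) c (γ + y)
    (by rw [map_add, hγ, hy0, add_zero])
    (by rw [map_add, hy', add_sub_cancel])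
  refine ⟨Submodule.Quotient.mk b, ?_⟩
  rw [PairHom.pi0Map_mk, eq_comm, Submodule.Quotient.eq]
  exact ⟨β, by rw [hb, add_sub_cancel_left]⟩

/-- Exactness of `π₀` transfers to `π₁` along isomorphisms compatible with the differentials. -/
theorem ker_pi1Map_le_range (C : SecondaryComplex B)
    (σ : ∀ n : ℤ, ((C.M n).pi1 : Type u) ≃ₗ[B.B0] (C.M n).pi0)
    (hσ : ∀ (n : ℤ) (x : (C.M (n + 1)).pi1),
      σ n ((C.d n).pi1Map x) = (C.d n).pi0Map (σ (n + 1) x))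
    (n : ℤ)
    (h : LinearMap.ker ((C.d n).pi0Map) ≤ LinearMap.range ((C.d (n + 1)).pi0Map)) :
    LinearMap.ker ((C.d n).pi1Map) ≤ LinearMap.range ((C.d (n + 1)).pi1Map) := by
  intro x hx
  rw [LinearMap.mem_ker] at hx
  obtain ⟨z, hz⟩ := h (x := σ (n + 1) x) (by rw [LinearMap.mem_ker, ← hσ, hx, map_zero])
  refine ⟨(σ (n + 1 + 1)).symm z, (σ (n + 1)).injective ?_⟩
  rw [hσ, LinearEquiv.apply_symm_apply, hz]

end SecondaryComplex

/-- **Statement 3.**  Let `B` be a pair algebra with `Σ`-structure and `M•` a secondary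
chain complex of `B`-modules with `Σ`-structures whose differentials are `Σ`-maps.  If `M•`
is exact (its total complex is exact) and `π₀M•` is bounded below, then the chain complex
`π₀M•` of `π₀B`-modules is exact. -/
theorem pi0_exact_of_secondaryComplex_isExact
    (σB : B.SigmaStructure) (C : SecondaryComplex B)
    (σ : ∀ n : ℤ, ((C.M n).pi1 : Type u) ≃ₗ[B.B0] (C.M n).pi0)
    (hσ : ∀ (n : ℤ) (x : (C.M (n + 1)).pi1),
      σ n ((C.d n).pi1Map x) = (C.d n).pi0Map (σ (n + 1) x))
    (hsecexact : C.IsExact)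
    (hbounded : ∃ n₀ : ℤ, ∀ n < n₀, Subsingleton ((C.M n).pi0)) :
    ∀ n : ℤ,
      LinearMap.ker ((C.d n).pi0Map) = LinearMap.range ((C.d (n + 1)).pi0Map) := by
  obtain ⟨n₀, hn₀⟩ := hbounded
  have key : ∀ (j : ℕ) (n : ℤ), n + 1 < n₀ + j →
      LinearMap.ker ((C.d n).pi0Map) ≤ LinearMap.range ((C.d (n + 1)).pi0Map) := by
    intro j
    induction j with
    | zero =>
      intro n hn x _
      have := hn₀ (n + 1) (by simpa using hn)
      rw [Subsingleton.elim x 0]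
      exact zero_mem _
    | succ j ih =>
      intro n hn
      obtain ⟨m, rfl⟩ : ∃ m : ℤ, n = m + 1 + 1 := ⟨n - 2, by ring⟩
      exact hsecexact.ker_pi0Map_le_range m
        (C.ker_pi1Map_le_range σ hσ m (ih m (by push_cast at hn; omega)))
  intro n
  exact le_antisymm (key (n + 2 - n₀).toNat n (by omega)) (C.range_pi0Map_le_ker n)
end
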